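/- arXiv:math/0507598 — 8 statements merged into one kernel-verified Lean document; each statement's English description precedes it below -/
import Mathlib

section
/- Let q be a prime power, P ⊆ ℝ² an integral convex polygon with P ∩ ℤ² ⊆ {0,…,q−2}², and P₁, …, P_ℓ integral convex polygons with P_i ∩ ℤ² ⊆ {0,…,q−2}² for each i and with Minkowski sum P₁ + ⋯ + P_ℓ ⊆ P. For each i, let m_i be the maximum, over all nonzero polynomials f ∈ 𝔽_q[x,y] whose support is contained in P_i ∩ ℤ², of the number of points of (𝔽_q^*)² at which f vanishes, and suppose there exist nonzero polynomials f₁, …, f_ℓ, with f_i supported in P_i ∩ ℤ² and vanishing at exactly m_i points of (𝔽_q^*)², whose zero sets in (𝔽_q^*)² are pairwise disjoint. Then d(C_P(𝔽_q)) ≤ Σ_{i=1}^ℓ d(C_{P_i}(𝔽_q)) − (ℓ−1)(q−1)². -/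
open Pointwise

/-- Embed a lattice point of `ℤ²` into `ℝ²`. -/
def toR2 (m : ℤ × ℤ) : ℝ × ℝ := ((m.1 : ℝ), (m.2 : ℝ))

/-- An integral convex polygon: the convex hull of a finite nonempty set of lattice points. -/
def IsIntPolygon (P : Set (ℝ × ℝ)) : Prop :=
  ∃ V : Finset (ℤ × ℤ), V.Nonempty ∧ P = convexHull ℝ (toR2 '' ↑V)

/-- The lattice points of a subset of `ℝ²`. -/
def latticePts (P : Set (ℝ × ℝ)) : Set (ℤ × ℤ) := {m | toR2 m ∈ P}

/-- `I(P)`: the number of lattice points in the interior of `P`. -/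
noncomputable def intPts (P : Set (ℝ × ℝ)) : ℕ := (latticePts (interior P)).ncard

/-- `#(P)`: the number of lattice points of `P`. -/
noncomputable def numPts (P : Set (ℝ × ℝ)) : ℕ := (latticePts P).ncard

/-- The lattice points of the square `□_{q-1} = [0, q-2] × [0, q-2]`. -/
def box (q : ℕ) : Set (ℤ × ℤ) :=
  {m | 0 ≤ m.1 ∧ m.1 ≤ (q : ℤ) - 2 ∧ 0 ≤ m.2 ∧ m.2 ≤ (q : ℤ) - 2}

/-- The evaluation vector of the monomial `x^{m₁} y^{m₂}` at all points of the torus `(F*)²`. -/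
def evalVec (F : Type) [Field F] (m : ℤ × ℤ) : Fˣ × Fˣ → F :=
  fun p => ((p.1 ^ m.1 * p.2 ^ m.2 : Fˣ) : F)

/-- The toric code associated to a set `S ⊆ ℤ²` of exponent vectors: the span of the
evaluation vectors of the corresponding monomials. -/
noncomputable def toricCode (F : Type) [Field F] (S : Set (ℤ × ℤ)) :
    Submodule F (Fˣ × Fˣ → F) :=
  Submodule.span F (evalVec F '' S)

/-- Hamming weight of a word indexed by the torus `(F*)²`. -/
noncomputable def wt {F : Type} [Field F] (c : Fˣ × Fˣ → F) : ℕ :=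
  {p | c p ≠ 0}.ncard

/-- Minimum distance of a linear code: minimum Hamming weight of a nonzero codeword. -/
noncomputable def minDist (F : Type) [Field F] (C : Submodule F (Fˣ × Fˣ → F)) : ℕ :=
  sInf {w | ∃ c ∈ C, c ≠ 0 ∧ wt c = w}

/-- The support of a bivariate polynomial, as a set of lattice points. -/
def suppZ {K : Type} [CommSemiring K] (f : MvPolynomial (Fin 2) K) : Set (ℤ × ℤ) :=
  (fun d : Fin 2 →₀ ℕ => ((d 0 : ℤ), (d 1 : ℤ))) '' ↑f.support

/-- The Newton polygon of a bivariate polynomial. -/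
noncomputable def NP {K : Type} [CommSemiring K] (f : MvPolynomial (Fin 2) K) :
    Set (ℝ × ℝ) :=
  convexHull ℝ (toR2 '' suppZ f)

/-- Evaluate a bivariate polynomial at a point of the torus `(F*)²`. -/
noncomputable def evalT {F : Type} [Field F] (f : MvPolynomial (Fin 2) F) (p : Fˣ × Fˣ) : F :=
  MvPolynomial.eval ![(p.1 : F), (p.2 : F)] f

/-- The number of points of the torus `(F*)²` at which `f` vanishes. -/
noncomputable def nzeros {F : Type} [Field F] (f : MvPolynomial (Fin 2) F) : ℕ :=
  {p : Fˣ × Fˣ | evalT f p = 0}.ncard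

theorem suppZ_subset_iff {K : Type} [CommSemiring K] {f : MvPolynomial (Fin 2) K}
    {S : Set (ℤ × ℤ)} :
    suppZ f ⊆ S ↔ ∀ d ∈ f.support, ((d 0 : ℤ), (d 1 : ℤ)) ∈ S := by
  simp [suppZ, Set.subset_def]

theorem toR2_add (a b : ℤ × ℤ) : toR2 (a + b) = toR2 a + toR2 b := by
  simp [toR2]

theorem suppZ_mul_subset_latticePts {K : Type} [CommSemiring K]
    {f g : MvPolynomial (Fin 2) K} {P Q : Set (ℝ × ℝ)}
    (hf : suppZ f ⊆ latticePts P) (hg : suppZ g ⊆ latticePts Q) :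
    suppZ (f * g) ⊆ latticePts (P + Q) := by
  rw [suppZ_subset_iff] at *
  intro d hd
  obtain ⟨a, ha, b, hb, rfl⟩ := Finset.mem_add.1 (MvPolynomial.support_mul f g hd)
  refine Set.mem_add.2 ⟨_, hf a ha, _, hg b hb, ?_⟩
  rw [← toR2_add]
  simp

theorem suppZ_prod_subset_latticePts {K ι : Type} [CommSemiring K] (s : Finset ι)
    (f : ι → MvPolynomial (Fin 2) K) (P : ι → Set (ℝ × ℝ))
    (hf : ∀ i ∈ s, suppZ (f i) ⊆ latticePts (P i)) :
    suppZ (∏ i ∈ s, f i) ⊆ latticePts (∑ i ∈ s, P i) := by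
  classical
  induction s using Finset.induction_on with
  | empty =>
    rw [suppZ_subset_iff]
    intro d hd
    have hd0 : d = 0 := by
      by_contra h
      simp [MvPolynomial.coeff_one, Ne.symm h] at hd
    subst hd0
    simp [latticePts, toR2]
  | insert a s ha ih =>
    rw [Finset.prod_insert ha, Finset.sum_insert ha]
    exact suppZ_mul_subset_latticePts (hf a (Finset.mem_insert_self a s))
      (ih fun i hi => hf i (Finset.mem_insert_of_mem hi))

theorem evalT_mem_toricCode {F : Type} [Field F] {f : MvPolynomial (Fin 2) F}
    {S : Set (ℤ × ℤ)} (hf : suppZ f ⊆ S) : evalT f ∈ toricCode F S := by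
  rw [suppZ_subset_iff] at hf
  have h : evalT f = ∑ d ∈ f.support, f.coeff d • evalVec F ((d 0 : ℤ), (d 1 : ℤ)) := by
    ext p
    simp [evalT, evalVec, MvPolynomial.eval_eq']
  rw [h]
  exact Submodule.sum_mem _ fun d hd =>
    Submodule.smul_mem _ _ (Submodule.subset_span ⟨_, hf d hd, rfl⟩)

theorem exists_evalT_eq_of_mem_toricCode {F : Type} [Field F] {S : Set (ℤ × ℤ)}
    (hS : ∀ m ∈ S, 0 ≤ m.1 ∧ 0 ≤ m.2) {c : Fˣ × Fˣ → F} (hc : c ∈ toricCode F S) :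
    ∃ f : MvPolynomial (Fin 2) F, suppZ f ⊆ S ∧ evalT f = c := by
  classical
  induction hc using Submodule.span_induction with
  | mem c hc =>
    obtain ⟨⟨a, b⟩, hm, rfl⟩ := hc
    obtain ⟨ha, hb⟩ := hS _ hm
    lift a to ℕ using ha
    lift b to ℕ using hb
    refine ⟨MvPolynomial.monomial (Finsupp.single 0 a + Finsupp.single 1 b) 1, ?_, ?_⟩
    · rw [suppZ_subset_iff]
      intro d hd
      rw [Finset.mem_singleton.1 (MvPolynomial.support_monomial_subset hd)]
      simpa using hm
    · ext p
      simp [evalT, evalVec, MvPolynomial.eval_eq', MvPolynomial.support_monomial]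
  | zero => exact ⟨0, by simp [suppZ], by ext p; simp [evalT]⟩
  | add x y _ _ hx hy =>
    obtain ⟨f, hf, rfl⟩ := hx
    obtain ⟨g, hg, rfl⟩ := hy
    refine ⟨f + g, ?_, by ext p; simp [evalT]⟩
    rw [suppZ_subset_iff] at *
    intro d hd
    exact (Finset.mem_union.1 (MvPolynomial.support_add hd)).elim (hf d) (hg d)
  | smul r x _ hx =>
    obtain ⟨f, hf, rfl⟩ := hx
    refine ⟨r • f, ?_, by ext p; simp [evalT]⟩
    rw [suppZ_subset_iff] at *
    exact fun d hd => hf d (MvPolynomial.support_smul hd)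

theorem evalT_ne_zero {F : Type} [Field F] [Fintype F] {f : MvPolynomial (Fin 2) F}
    (hf : f ≠ 0) (hbox : suppZ f ⊆ box (Fintype.card F)) : evalT f ≠ 0 := by
  classical
  intro h0
  refine hf (MvPolynomial.eq_zero_of_eval_zero_at_prod_finset f
    (fun _ => Finset.univ.erase 0) (fun i => ?_) fun x hx => ?_)
  · have hcard : 1 < Fintype.card F := Fintype.one_lt_card
    rw [Finset.card_erase_of_mem (Finset.mem_univ _), Finset.card_univ,
      MvPolynomial.degreeOf_lt_iff (by omega)]
    intro d hd
    obtain ⟨-, h1, -, h2⟩ := suppZ_subset_iff.1 hbox d hd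
    fin_cases i <;> dsimp at * <;> omega
  · have hx0 : ∀ i, x i ≠ 0 := fun i => Finset.ne_of_mem_erase (hx i)
    have h := congrFun h0 (Units.mk0 (x 0) (hx0 0), Units.mk0 (x 1) (hx0 1))
    have hx' : ![x 0, x 1] = x := by
      ext i
      fin_cases i <;> rfl
    simpa [evalT, hx'] using h

theorem wt_evalT_add_nzeros {F : Type} [Field F] [Fintype F] (f : MvPolynomial (Fin 2) F) :
    wt (evalT f) + nzeros f = (Fintype.card F - 1) ^ 2 := by
  classical
  have h := Set.ncard_add_ncard_compl {p : Fˣ × Fˣ | evalT f p = 0}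
  rw [Nat.card_prod, Nat.card_eq_fintype_card, Fintype.card_units, ← sq] at h
  rw [add_comm]
  exact h

theorem nzeros_prod {F ι : Type} [Field F] [Fintype F] [Fintype ι]
    (f : ι → MvPolynomial (Fin 2) F)
    (hdisj : ∀ i j, i ≠ j → ∀ p : Fˣ × Fˣ, evalT (f i) p = 0 → evalT (f j) p ≠ 0) :
    nzeros (∏ i, f i) = ∑ i, nzeros (f i) := by
  have h : {p : Fˣ × Fˣ | evalT (∏ i, f i) p = 0} = ⋃ i, {p | evalT (f i) p = 0} := by
    ext p
    simp [evalT, map_prod, Finset.prod_eq_zero_iff]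
  rw [nzeros, h, Set.ncard_iUnion_of_finite (fun i => Set.toFinite _), finsum_eq_sum_of_fintype]
  · rfl
  · exact fun i j hij => Set.disjoint_left.2 (hdisj i j hij)

/-- The minimum distance of a toric code is at most the weight of any nonzero polynomial
section. -/
theorem minDist_toricCode_add_nzeros_le {F : Type} [Field F] [Fintype F] {S : Set (ℤ × ℤ)}
    (hS : S ⊆ box (Fintype.card F)) {f : MvPolynomial (Fin 2) F} (hf : f ≠ 0)
    (hfS : suppZ f ⊆ S) :
    minDist F (toricCode F S) + nzeros f ≤ (Fintype.card F - 1) ^ 2 := by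
  rw [← wt_evalT_add_nzeros f]
  have h : minDist F (toricCode F S) ≤ wt (evalT f) :=
    Nat.sInf_le ⟨_, evalT_mem_toricCode hfS, evalT_ne_zero hf (hfS.trans hS), rfl⟩
  exact Nat.add_le_add_right h _

/-- An upper bound on the number of zeros of nonzero sections gives a lower bound on the
minimum distance. -/
theorem le_minDist_toricCode_add {F : Type} [Field F] [Fintype F] {S : Set (ℤ × ℤ)}
    (hS : S ⊆ box (Fintype.card F)) {f : MvPolynomial (Fin 2) F} (hf : f ≠ 0)
    (hfS : suppZ f ⊆ S) {m : ℕ}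
    (hmax : ∀ g : MvPolynomial (Fin 2) F, g ≠ 0 → suppZ g ⊆ S → nzeros g ≤ m) :
    (Fintype.card F - 1) ^ 2 ≤ minDist F (toricCode F S) + m := by
  obtain ⟨c, hc, hc0, hcw⟩ : minDist F (toricCode F S) ∈
      {w | ∃ c ∈ toricCode F S, c ≠ 0 ∧ wt c = w} :=
    Nat.sInf_mem ⟨_, _, evalT_mem_toricCode hfS, evalT_ne_zero hf (hfS.trans hS), rfl⟩
  obtain ⟨g, hgS, rfl⟩ := exists_evalT_eq_of_mem_toricCode
    (fun m hm => ⟨(hS hm).1, (hS hm).2.2.1⟩) hc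
  have hg : g ≠ 0 := by
    rintro rfl
    exact hc0 (by ext p; simp [evalT])
  rw [← hcw, ← wt_evalT_add_nzeros g]
  exact Nat.add_le_add_left (hmax g hg hgS) _

/-- Proposition 2.3: upper bound on the minimum distance of a toric code from a
Minkowski sum decomposition of a subpolygon, given sections with maximally many,
pairwise disjoint, zero sets. -/
theorem upper_bound_minkowski (q : ℕ) (F : Type) [Field F] [Fintype F]
    (hF : Fintype.card F = q)
    (P : Set (ℝ × ℝ)) (hP : IsIntPolygon P) (hPbox : latticePts P ⊆ box q)
    (ℓ : ℕ) (Pi : Fin ℓ → Set (ℝ × ℝ)) (hPi : ∀ i, IsIntPolygon (Pi i))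
    (hPibox : ∀ i, latticePts (Pi i) ⊆ box q)
    (hsum : (∑ i, Pi i) ⊆ P)
    (m : Fin ℓ → ℕ)
    (hmax : ∀ i, ∀ f : MvPolynomial (Fin 2) F,
      f ≠ 0 → suppZ f ⊆ latticePts (Pi i) → nzeros f ≤ m i)
    (f : Fin ℓ → MvPolynomial (Fin 2) F)
    (hf : ∀ i, f i ≠ 0 ∧ suppZ (f i) ⊆ latticePts (Pi i) ∧ nzeros (f i) = m i)
    (hdisj : ∀ i j, i ≠ j → ∀ p : Fˣ × Fˣ, evalT (f i) p = 0 → evalT (f j) p ≠ 0) :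
    (minDist F (toricCode F (latticePts P)) : ℤ) ≤
      (∑ i, (minDist F (toricCode F (latticePts (Pi i))) : ℤ)) -
        ((ℓ : ℤ) - 1) * ((q : ℤ) - 1) ^ 2 := by
  subst hF
  have hupper := minDist_toricCode_add_nzeros_le hPbox
    (Finset.prod_ne_zero_iff.2 fun i _ => (hf i).1)
    ((suppZ_prod_subset_latticePts Finset.univ f Pi fun i _ => (hf i).2.1).trans
      fun _ hp => hsum hp)
  have hlower : ∑ _i : Fin ℓ, (Fintype.card F - 1) ^ 2 ≤
      ∑ i, (minDist F (toricCode F (latticePts (Pi i))) + m i) :=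
    Finset.sum_le_sum fun i _ =>
      le_minDist_toricCode_add (hPibox i) (hf i).1 (hf i).2.1 (hmax i)
  rw [nzeros_prod f hdisj, Finset.sum_congr rfl fun i _ => (hf i).2.2] at hupper
  rw [Finset.sum_add_distrib, Finset.sum_const, Finset.card_univ, Fintype.card_fin,
    smul_eq_mul] at hlower
  zify [Fintype.card_pos (α := F)] at hupper hlower
  linarith
end

section
/- Let d, e, r be integers with d, e, r ≥ 1, let q be a prime power with e + dr < q − 1, and let P = conv{(0,0),(d,0),(0,e),(d,e+rd)} (the polygon defining the Hirzebruch surface ℋ_r). Then d(C_P(𝔽_q)) = (q−1)² − (rd + e)(q−1). -/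
open Pointwise

open Polynomial in
/-- The number of nonzero roots of a polynomial is at most the difference between its degree and
its order of vanishing at `0`. -/
theorem card_units_roots_add_natTrailingDegree_le {F : Type} [Field F] {c : F[X]} (hc : c ≠ 0)
    (s : Finset Fˣ) (hs : ∀ x ∈ s, c.eval (x : F) = 0) :
    s.card + c.natTrailingDegree ≤ c.natDegree := by
  classical
  obtain ⟨g, hg⟩ : X ^ c.natTrailingDegree ∣ c :=
    X_pow_dvd_iff.2 fun _ h => coeff_eq_zero_of_lt_natTrailingDegree h
  have hg0 : g ≠ 0 := by
    rintro rfl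
    exact hc (by simpa using hg)
  have hdeg : c.natDegree = c.natTrailingDegree + g.natDegree := by
    conv_lhs => rw [hg]
    rw [natDegree_mul (pow_ne_zero _ X_ne_zero) hg0, natDegree_X_pow]
  have hsub : s.image (fun x : Fˣ => (x : F)) ⊆ g.roots.toFinset := by
    intro z hz
    obtain ⟨x, hx, rfl⟩ := Finset.mem_image.1 hz
    have h := hs x hx
    rw [hg, eval_mul, eval_pow, eval_X] at h
    simpa [hg0] using h
  have h1 := Finset.card_le_card hsub
  rw [Finset.card_image_of_injective _ Units.val_injective] at h1
  have h2 := Multiset.toFinset_card_le g.roots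
  have h3 := card_roots' g
  omega

open Polynomial in
/-- Every word of a toric code with exponents below the line `m₂ = e + r m₁` and left of
`m₁ = d` is the evaluation of a polynomial in `y` over `F[x]` with that support. -/
theorem exists_polynomial_of_mem_toricCode {F : Type} [Field F] {d e r : ℕ} {S : Set (ℤ × ℤ)}
    (hS : ∀ m ∈ S, 0 ≤ m.1 ∧ m.1 ≤ d ∧ 0 ≤ m.2 ∧ m.2 ≤ e + r * m.1)
    {w : Fˣ × Fˣ → F} (hw : w ∈ toricCode F S) :
    ∃ p : F[X][X], (∀ j i, (p.coeff j).coeff i ≠ 0 → i ≤ d ∧ j ≤ e + r * i) ∧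
      ∀ x y : Fˣ, w (x, y) = (p.map (evalRingHom (x : F))).eval (y : F) := by
  induction hw using Submodule.span_induction with
  | mem w hw =>
    obtain ⟨⟨a, b⟩, hm, rfl⟩ := hw
    obtain ⟨ha, had, hb, hbe⟩ := hS _ hm
    dsimp only at ha had hb hbe
    lift a to ℕ using ha
    lift b to ℕ using hb
    refine ⟨monomial b (monomial a 1), fun j i h => ?_, fun x y => ?_⟩
    · rw [coeff_monomial] at h
      split_ifs at h with hbj
      · rw [coeff_monomial] at h
        split_ifs at h with hai
        · subst hbj hai
          exact ⟨by exact_mod_cast had, by exact_mod_cast hbe⟩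
        · exact absurd rfl h
      · exact absurd (coeff_zero i) h
    · simp [evalVec]
  | zero => exact ⟨0, by simp, by simp⟩
  | add w₁ w₂ _ _ h₁ h₂ =>
    obtain ⟨p₁, hp₁, he₁⟩ := h₁
    obtain ⟨p₂, hp₂, he₂⟩ := h₂
    refine ⟨p₁ + p₂, fun j i h => ?_, fun x y => by simp [he₁, he₂]⟩
    by_cases h1 : (p₁.coeff j).coeff i = 0
    · refine hp₂ j i fun h2 => h ?_
      simp [h1, h2]
    · exact hp₁ j i h1
  | smul a w _ h =>
    obtain ⟨p, hp, hev⟩ := h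
    refine ⟨C (C a) * p, fun j i h => hp j i fun h0 => h ?_, fun x y => by simp [hev]⟩
    simp [h0]

/-- The Hamming weight, counted along vertical lines. -/
theorem wt_eq_sum {F : Type} [Field F] [Fintype F] [DecidableEq F] (w : Fˣ × Fˣ → F) :
    wt w = ∑ x : Fˣ, (Finset.univ.filter fun y : Fˣ => w (x, y) ≠ 0).card := by
  have : {p | w p ≠ 0} = ((Finset.univ.filter fun p => w p ≠ 0 : Finset (Fˣ × Fˣ)) : Set _) := by
    ext; simp
  rw [wt, this, Set.ncard_coe_finset, Finset.card_filter, Fintype.sum_prod_type]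
  simp only [Finset.card_filter]

open Polynomial in
/-- Lower bound for the weight of a nonzero word with trapezoidal support. -/
theorem le_wt_of_mem_toricCode {F : Type} [Field F] [Fintype F] [DecidableEq F] {d e r : ℕ}
    (hr : 1 ≤ r) (hN : e + d * r ≤ Fintype.card Fˣ) {S : Set (ℤ × ℤ)}
    (hS : ∀ m ∈ S, 0 ≤ m.1 ∧ m.1 ≤ d ∧ 0 ≤ m.2 ∧ m.2 ≤ e + r * m.1)
    {w : Fˣ × Fˣ → F} (hw : w ∈ toricCode F S) (hw0 : w ≠ 0) :
    Fintype.card Fˣ * (Fintype.card Fˣ - (e + d * r)) ≤ wt w := by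
  obtain ⟨p, hp, hev⟩ := exists_polynomial_of_mem_toricCode hS hw
  have hp0 : p ≠ 0 := by
    rintro rfl
    exact hw0 (funext fun z => by simpa using hev z.1 z.2)
  set N := Fintype.card Fˣ
  set c := p.leadingCoeff
  have hc0 : c ≠ 0 := leadingCoeff_ne_zero.2 hp0
  set s := Finset.univ.filter fun x : Fˣ => c.eval (x : F) = 0
  have hs := card_units_roots_add_natTrailingDegree_le hc0 s (by simp [s])
  have hdeg : c.natDegree ≤ d :=
    (hp p.natDegree c.natDegree (leadingCoeff_ne_zero.2 hc0)).1
  have htrail : p.natDegree ≤ e + r * c.natTrailingDegree :=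
    (hp p.natDegree c.natTrailingDegree (trailingCoeff_nonzero_iff_nonzero.2 hc0)).2
  obtain ⟨t, ht⟩ : ∃ t, d = s.card + t := ⟨d - s.card, by omega⟩
  have hj : p.natDegree ≤ e + r * t :=
    htrail.trans (by gcongr; omega)
  have hline : ∀ x ∈ sᶜ, N - (e + r * t) ≤
      (Finset.univ.filter fun y : Fˣ => w (x, y) ≠ 0).card := by
    intro x hx
    have hx : c.eval (x : F) ≠ 0 := by simpa [s] using hx
    have hpx : p.map (evalRingHom (x : F)) ≠ 0 := by
      intro h
      apply hx
      have h' := congrArg (fun g => g.coeff p.natDegree) h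
      rwa [coeff_map, coeff_zero] at h'
    have hz := card_units_roots_add_natTrailingDegree_le hpx
      (Finset.univ.filter fun y : Fˣ => w (x, y) = 0) (by simp [hev])
    have hle := natDegree_map_le (f := evalRingHom (x : F)) (p := p)
    have hsplit := Finset.card_filter_add_card_filter_not
      (s := (Finset.univ : Finset Fˣ)) (fun y => w (x, y) = 0)
    rw [Finset.card_univ] at hsplit
    simp only [ne_eq]
    omega
  have hcompl : sᶜ.card = N - s.card := Finset.card_compl s
  have hsN : s.card ≤ N := Finset.card_le_univ s
  have hsum : (N - s.card) * (N - (e + r * t)) ≤ wt w := by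
    rw [wt_eq_sum, ← hcompl, ← smul_eq_mul]
    exact (Finset.card_nsmul_le_sum _ _ _ hline).trans
      (Finset.sum_le_sum_of_subset (Finset.subset_univ _))
  refine le_trans ?_ hsum
  have htN : e + r * t ≤ N := by
    refine le_trans ?_ hN
    rw [ht]
    nlinarith [Nat.zero_le (s.card * r)]
  zify [hsN, htN, hN]
  obtain ⟨u, rfl⟩ := Nat.exists_eq_add_of_le hr
  have hd : (d : ℤ) = s.card + t := by exact_mod_cast ht
  rw [hd]
  push_cast
  have h1 : (0 : ℤ) ≤ s.card * (N * u + e + (1 + u) * t) := by positivity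
  linarith

open Polynomial in
/-- A word `x ^ a * ∏ (y - b)` with `k` distinct factors lies in the code as soon as the vertical
lattice segment from `(a, 0)` to `(a, k)` lies in `S`. -/
theorem exists_mem_toricCode_wt_eq {F : Type} [Field F] [Fintype F] [DecidableEq F] {k : ℕ}
    (hk : k < Fintype.card Fˣ) (a : ℤ) {S : Set (ℤ × ℤ)}
    (hS : ∀ j ≤ k, (a, (j : ℤ)) ∈ S) :
    ∃ w ∈ toricCode F S, w ≠ 0 ∧ wt w = Fintype.card Fˣ * (Fintype.card Fˣ - k) := by
  obtain ⟨A, -, hA⟩ := Finset.exists_subset_card_eq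
    (s := (Finset.univ : Finset Fˣ)) (n := k) (by simpa using hk.le)
  set Q : F[X] := ∏ b ∈ A, (X - C (b : F)) with hQ
  have hQdeg : Q.natDegree = k := by
    rw [hQ, natDegree_prod_of_monic _ _ fun b _ => monic_X_sub_C _]
    simp [hA]
  set w : Fˣ × Fˣ → F := fun z => ((z.1 ^ a : Fˣ) : F) * Q.eval (z.2 : F) with hw
  have hzero : ∀ x y, w (x, y) ≠ 0 ↔ y ∉ A := by
    intro x y
    rw [hw]
    simp only [ne_eq, mul_eq_zero, Units.ne_zero, false_or, hQ, eval_prod, Finset.prod_eq_zero_iff,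
      eval_sub, eval_X, eval_C, sub_eq_zero, Units.val_inj]
    simp
  have hwt : wt w = Fintype.card Fˣ * (Fintype.card Fˣ - k) := by
    rw [wt_eq_sum]
    simp only [hzero]
    have : (Finset.univ.filter fun y : Fˣ => y ∉ A) = Aᶜ := by ext; simp
    rw [this, Finset.card_compl, hA]
    simp
  refine ⟨w, ?_, ?_, hwt⟩
  · have : w = ∑ j ∈ Finset.range (k + 1), Q.coeff j • evalVec F (a, (j : ℤ)) := by
      funext z
      simp only [hw, Finset.sum_apply, Pi.smul_apply, smul_eq_mul, evalVec, zpow_natCast,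
        eval_eq_sum_range, hQdeg, Finset.mul_sum, Units.val_mul, Units.val_pow_eq_pow_val]
      exact Finset.sum_congr rfl fun j _ => by ring
    rw [this]
    refine Submodule.sum_mem _ fun j hj => Submodule.smul_mem _ _ (Submodule.subset_span ?_)
    exact ⟨_, hS j (Nat.lt_succ_iff.1 (Finset.mem_range.1 hj)), rfl⟩
  · intro h
    have hcard : A ≠ Finset.univ := by
      rintro rfl
      rw [Finset.card_univ] at hA
      omega
    obtain ⟨y, hy⟩ : ∃ y, y ∉ A := by
      by_contra! hall
      exact hcard (Finset.eq_univ_iff_forall.2 hall)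
    exact (hzero 1 y).2 hy (congrFun h _)

/-- The trapezoid with vertices `(0,0)`, `(d,0)`, `(0,e)`, `(d,e+rd)` satisfies the expected
inequalities. -/
theorem convexHull_trapezoid_subset (d e r : ℕ) :
    convexHull ℝ {((0 : ℝ), (0 : ℝ)), ((d : ℝ), (0 : ℝ)), ((0 : ℝ), (e : ℝ)),
        ((d : ℝ), (e : ℝ) + (r : ℝ) * (d : ℝ))} ⊆
      {z : ℝ × ℝ | 0 ≤ z.1 ∧ z.1 ≤ d ∧ 0 ≤ z.2 ∧ z.2 ≤ e + r * z.1} := by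
  refine convexHull_min ?_ ?_
  · have : (0 : ℝ) ≤ e + r * d := by positivity
    rintro z (rfl | rfl | rfl | rfl) <;> simp [this]
  · rintro ⟨x₁, y₁⟩ ⟨h₁, h₂, h₃, h₄⟩ ⟨x₂, y₂⟩ ⟨k₁, k₂, k₃, k₄⟩ a b ha hb hab
    dsimp only at h₁ h₂ h₃ h₄ k₁ k₂ k₃ k₄
    simp only [Set.mem_ofPred_eq, Prod.smul_mk, Prod.mk_add_mk, smul_eq_mul]
    obtain rfl : b = 1 - a := by linarith
    refine ⟨by positivity, ?_, by positivity, ?_⟩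
    · linarith [mul_le_mul_of_nonneg_left h₂ ha, mul_le_mul_of_nonneg_left k₂ hb]
    · linarith [mul_le_mul_of_nonneg_left h₄ ha, mul_le_mul_of_nonneg_left k₄ hb]

/-- The right edge of the trapezoid lies in the convex hull of its vertices. -/
theorem mem_convexHull_trapezoid (d e r : ℕ) {t : ℝ} (ht : 0 ≤ t) (ht' : t ≤ e + r * d) :
    ((d : ℝ), t) ∈ convexHull ℝ {((0 : ℝ), (0 : ℝ)), ((d : ℝ), (0 : ℝ)), ((0 : ℝ), (e : ℝ)),
        ((d : ℝ), (e : ℝ) + (r : ℝ) * (d : ℝ))} := by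
  refine segment_subset_convexHull (x := ((d : ℝ), (0 : ℝ)))
    (y := ((d : ℝ), (e : ℝ) + (r : ℝ) * (d : ℝ))) (by simp) (by simp) ?_
  rw [← Prod.image_mk_segment_right, segment_eq_Icc (ht.trans ht')]
  exact ⟨t, ⟨ht, ht'⟩, rfl⟩

/-- Example 3.3: the minimum distance of the toric code of the polygon defining
the Hirzebruch surface `ℋ_r`. -/
theorem hirzebruch_minDist (q : ℕ) (F : Type) [Field F] [Fintype F]
    (hF : Fintype.card F = q)
    (d e r : ℕ) (hd : 1 ≤ d) (he : 1 ≤ e) (hr : 1 ≤ r)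
    (hq : e + d * r + 1 < q)
    (P : Set (ℝ × ℝ))
    (hP : P = convexHull ℝ
      {((0 : ℝ), (0 : ℝ)), ((d : ℝ), (0 : ℝ)), ((0 : ℝ), (e : ℝ)),
        ((d : ℝ), (e : ℝ) + (r : ℝ) * (d : ℝ))}) :
    (minDist F (toricCode F (latticePts P)) : ℤ) =
      ((q : ℤ) - 1) ^ 2 - (r * d + e) * ((q : ℤ) - 1) := by
  classical
  have hcard : Fintype.card Fˣ + 1 = q := by
    rw [Fintype.card_units, hF]
    omega
  set N := Fintype.card Fˣ
  have hS : ∀ m ∈ latticePts P, 0 ≤ m.1 ∧ m.1 ≤ d ∧ 0 ≤ m.2 ∧ m.2 ≤ e + r * m.1 := by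
    intro m hm
    rw [latticePts, Set.mem_ofPred_eq, hP] at hm
    have h := convexHull_trapezoid_subset d e r hm
    simp only [toR2, Set.mem_ofPred_eq] at h
    exact_mod_cast h
  have hedge : ∀ j ≤ e + d * r, ((d : ℤ), (j : ℤ)) ∈ latticePts P := by
    intro j hj
    rw [latticePts, Set.mem_ofPred_eq, hP]
    have hj' : (j : ℝ) ≤ e + r * d := by
      rw [mul_comm (r : ℝ)]
      exact_mod_cast hj
    simpa [toR2] using mem_convexHull_trapezoid d e r (Nat.cast_nonneg j) hj'
  have hlt : e + d * r < N := by omega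
  have hmin : minDist F (toricCode F (latticePts P)) = N * (N - (e + d * r)) := by
    obtain ⟨w, hw, hw0, hwt⟩ := exists_mem_toricCode_wt_eq hlt d hedge
    refine le_antisymm (Nat.sInf_le ⟨w, hw, hw0, hwt⟩) (le_csInf ⟨_, w, hw, hw0, hwt⟩ ?_)
    rintro _ ⟨v, hv, hv0, rfl⟩
    exact le_wt_of_mem_toricCode hr hlt.le hS hv hv0
  rw [hmin, ← hcard]
  push_cast [hlt.le]
  ring
end

section
/- Let d, e be integers with 1 ≤ d ≤ q − 2 and 1 ≤ e ≤ q − 2 for a prime power q, and let P = conv{(0,0),(d,0),(0,e),(d,e)} be the d × e rectangle [0,d] × [0,e]. Then d(C_P(𝔽_q)) = (q−1)² − (d + e)(q−1) + de, and minimum weight codewords are obtained by evaluating the reducible sections ∏_{i=1}^d (x − α_i) · ∏_{j=1}^e (y − β_j), where α₁, …, α_d are distinct elements of 𝔽_q^* and β₁, …, β_e are distinct elements of 𝔽_q^*. -/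
open Pointwise

/-- The reducible section `∏ᵢ (x - αᵢ) ∏ⱼ (y - βⱼ)`. -/
noncomputable def rectSection (F : Type) [Field F] {d e : ℕ}
    (α : Fin d → Fˣ) (β : Fin e → Fˣ) : MvPolynomial (Fin 2) F :=
  (∏ i, (MvPolynomial.X 0 - MvPolynomial.C ((α i : F)))) *
    (∏ j, (MvPolynomial.X 1 - MvPolynomial.C ((β j : F))))

theorem mem_latticePts_rectangle {d e : ℕ} {m : ℤ × ℤ} :
    m ∈ latticePts (convexHull ℝ
      {((0 : ℝ), (0 : ℝ)), ((d : ℝ), (0 : ℝ)), ((0 : ℝ), (e : ℝ)), ((d : ℝ), (e : ℝ))}) ↔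
      (0 ≤ m.1 ∧ m.1 ≤ d) ∧ 0 ≤ m.2 ∧ m.2 ≤ e := by
  have hset : ({((0 : ℝ), (0 : ℝ)), ((d : ℝ), (0 : ℝ)), ((0 : ℝ), (e : ℝ)), ((d : ℝ), (e : ℝ))} :
      Set (ℝ × ℝ)) = ({0, (d : ℝ)} : Set ℝ) ×ˢ ({0, (e : ℝ)} : Set ℝ) := by
    ext ⟨x, y⟩
    simp only [Set.mem_insert_iff, Set.mem_singleton_iff, Set.mem_prod, Prod.mk.injEq]
    tauto
  rw [hset, convexHull_prod, convexHull_pair, convexHull_pair,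
    segment_eq_Icc (Nat.cast_nonneg d), segment_eq_Icc (Nat.cast_nonneg e)]
  simp only [latticePts, toR2, Set.mem_ofPred_eq, Set.mem_prod, Set.mem_Icc]
  norm_cast

/-- A polynomial of degree at most `d` that does not vanish identically on `Fˣ` is nonzero
at no fewer than `|Fˣ| - d` units. -/
theorem card_units_sub_le_ncard_eval_ne_zero {F : Type} [Field F] [Fintype F] {d : ℕ}
    {f : Polynomial F} (hf : f.natDegree ≤ d) {x₀ : Fˣ} (hx₀ : f.eval (x₀ : F) ≠ 0) :
    Nat.card Fˣ - d ≤ {x : Fˣ | f.eval (x : F) ≠ 0}.ncard := by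
  classical
  have hf0 : f ≠ 0 := by
    rintro rfl
    simp at hx₀
  have hroots : {x : Fˣ | f.eval (x : F) ≠ 0}ᶜ.ncard ≤ d := by
    calc {x : Fˣ | f.eval (x : F) ≠ 0}ᶜ.ncard
        = ((fun x : Fˣ => (x : F)) '' {x : Fˣ | f.eval (x : F) ≠ 0}ᶜ).ncard :=
          (Set.ncard_image_of_injective _ Units.val_injective).symm
      _ ≤ (f.roots.toFinset : Set F).ncard := by
          refine Set.ncard_le_ncard ?_ (Finset.finite_toSet _)
          rintro _ ⟨x, hx, rfl⟩
          simpa [hf0] using hx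
      _ = f.roots.toFinset.card := Set.ncard_coe_finset _
      _ ≤ d := (Multiset.toFinset_card_le _).trans ((Polynomial.card_roots' f).trans hf)
  have := Set.ncard_add_ncard_compl {x : Fˣ | f.eval (x : F) ≠ 0}
  omega

/-- Product bound on the support of a function of two variables, given a bound for the support
of each nonzero row and each nonzero column. -/
theorem mul_le_ncard_support_prod {A B F : Type} [Finite A] [Finite B] [Zero F] {a b : ℕ}
    {c : A × B → F}
    (hrow : ∀ x₀ y, c (x₀, y) ≠ 0 → a ≤ {x | c (x, y) ≠ 0}.ncard)
    (hcol : ∀ x y₀, c (x, y₀) ≠ 0 → b ≤ {y | c (x, y) ≠ 0}.ncard) (hc : c ≠ 0) :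
    a * b ≤ {p | c p ≠ 0}.ncard := by
  classical
  have := Fintype.ofFinite A
  have := Fintype.ofFinite B
  obtain ⟨⟨x₀, y₀⟩, h₀⟩ := Function.ne_iff.mp hc
  simp only [Set.ncard_eq_toFinset_card', Set.toFinset_ofPred] at *
  calc a * b ≤ (Finset.univ.filter fun x => c (x, y₀) ≠ 0).card * b :=
        Nat.mul_le_mul_right _ (hrow x₀ y₀ h₀)
    _ = ∑ x with c (x, y₀) ≠ 0, b := by simp
    _ ≤ ∑ x with c (x, y₀) ≠ 0, (Finset.univ.filter fun y => c (x, y) ≠ 0).card :=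
        Finset.sum_le_sum fun x hx => hcol x y₀ (Finset.mem_filter.mp hx).2
    _ = ((Finset.univ.filter fun x => c (x, y₀) ≠ 0).sigma
          fun x => Finset.univ.filter fun y => c (x, y) ≠ 0).card := (Finset.card_sigma _ _).symm
    _ ≤ (Finset.univ.filter fun p => c p ≠ 0).card := by
        refine Finset.card_le_card_of_injOn (fun s => (s.1, s.2)) ?_ ?_
        · rintro ⟨x, y⟩ h
          simpa using (Finset.mem_filter.mp (Finset.mem_sigma.mp h).2).2
        · rintro ⟨x, y⟩ - ⟨x', y'⟩ - h
          simpa using h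

section Rectangle

variable {F : Type} [Field F] {S : Set (ℤ × ℤ)} {d e : ℕ}

theorem exists_polynomial_row {c : Fˣ × Fˣ → F} (hS : ∀ m ∈ S, 0 ≤ m.1 ∧ m.1 ≤ d)
    (hc : c ∈ toricCode F S) (y : Fˣ) :
    ∃ f : Polynomial F, f.natDegree ≤ d ∧ ∀ x : Fˣ, c (x, y) = f.eval (x : F) := by
  induction hc using Submodule.span_induction with
  | mem c hc =>
    obtain ⟨⟨i, j⟩, hm, rfl⟩ := hc
    obtain ⟨h0, hi⟩ := hS _ hm
    lift i to ℕ using h0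
    refine ⟨Polynomial.C ((y ^ j : Fˣ) : F) * Polynomial.X ^ i,
      (Polynomial.natDegree_C_mul_X_pow_le _ _).trans (Int.ofNat_le.mp hi), fun x => ?_⟩
    simp only [evalVec, zpow_natCast, Units.val_mul, Units.val_pow_eq_pow_val,
      Polynomial.eval_mul, Polynomial.eval_C, Polynomial.eval_pow, Polynomial.eval_X]
    ring
  | zero => exact ⟨0, by simp, by simp⟩
  | add c c' _ _ h h' =>
    obtain ⟨f, hf, hcf⟩ := h
    obtain ⟨g, hg, hcg⟩ := h'
    exact ⟨f + g, Polynomial.natDegree_add_le_of_degree_le hf hg, by simp [hcf, hcg]⟩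
  | smul a c _ h =>
    obtain ⟨f, hf, hcf⟩ := h
    exact ⟨a • f, (Polynomial.natDegree_smul_le _ _).trans hf, by simp [hcf]⟩

theorem exists_polynomial_col {c : Fˣ × Fˣ → F} (hS : ∀ m ∈ S, 0 ≤ m.2 ∧ m.2 ≤ e)
    (hc : c ∈ toricCode F S) (x : Fˣ) :
    ∃ f : Polynomial F, f.natDegree ≤ e ∧ ∀ y : Fˣ, c (x, y) = f.eval (y : F) := by
  induction hc using Submodule.span_induction with
  | mem c hc =>
    obtain ⟨⟨i, j⟩, hm, rfl⟩ := hc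
    obtain ⟨h0, hj⟩ := hS _ hm
    lift j to ℕ using h0
    refine ⟨Polynomial.C ((x ^ i : Fˣ) : F) * Polynomial.X ^ j,
      (Polynomial.natDegree_C_mul_X_pow_le _ _).trans (Int.ofNat_le.mp hj), fun y => ?_⟩
    simp [evalVec]
  | zero => exact ⟨0, by simp, by simp⟩
  | add c c' _ _ h h' =>
    obtain ⟨f, hf, hcf⟩ := h
    obtain ⟨g, hg, hcg⟩ := h'
    exact ⟨f + g, Polynomial.natDegree_add_le_of_degree_le hf hg, by simp [hcf, hcg]⟩
  | smul a c _ h =>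
    obtain ⟨f, hf, hcf⟩ := h
    exact ⟨a • f, (Polynomial.natDegree_smul_le _ _).trans hf, by simp [hcf]⟩

theorem mul_le_wt_of_mem_toricCode [Fintype F] {c : Fˣ × Fˣ → F}
    (hS : ∀ m ∈ S, (0 ≤ m.1 ∧ m.1 ≤ d) ∧ 0 ≤ m.2 ∧ m.2 ≤ e)
    (hc : c ∈ toricCode F S) (hc0 : c ≠ 0) :
    (Nat.card Fˣ - d) * (Nat.card Fˣ - e) ≤ wt c := by
  refine mul_le_ncard_support_prod (fun x₀ y h => ?_) (fun x y₀ h => ?_) hc0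
  · obtain ⟨f, hf, hcf⟩ := exists_polynomial_row (fun m hm => (hS m hm).1) hc y
    simp only [hcf] at h ⊢
    exact card_units_sub_le_ncard_eval_ne_zero hf h
  · obtain ⟨f, hf, hcf⟩ := exists_polynomial_col (fun m hm => (hS m hm).2) hc x
    simp only [hcf] at h ⊢
    exact card_units_sub_le_ncard_eval_ne_zero hf h

theorem eval_mul_eval_mem_toricCode
    (hS : ∀ i j : ℕ, i ≤ d → j ≤ e → ((i : ℤ), (j : ℤ)) ∈ S)
    {f g : Polynomial F} (hf : f.natDegree ≤ d) (hg : g.natDegree ≤ e) :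
    (fun p : Fˣ × Fˣ => f.eval (p.1 : F) * g.eval (p.2 : F)) ∈ toricCode F S := by
  have hsum : (fun p : Fˣ × Fˣ => f.eval (p.1 : F) * g.eval (p.2 : F)) =
      ∑ i ∈ Finset.range (d + 1), ∑ j ∈ Finset.range (e + 1),
        (f.coeff i * g.coeff j) • evalVec F ((i : ℤ), (j : ℤ)) := by
    funext p
    rw [Polynomial.eval_eq_sum_range' (Nat.lt_succ_of_le hf),
      Polynomial.eval_eq_sum_range' (Nat.lt_succ_of_le hg), Finset.sum_mul_sum]
    simp only [Finset.sum_apply, Pi.smul_apply, smul_eq_mul, evalVec, zpow_natCast,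
      Units.val_mul, Units.val_pow_eq_pow_val]
    exact Finset.sum_congr rfl fun i _ => Finset.sum_congr rfl fun j _ => by ring
  rw [hsum]
  refine Submodule.sum_mem _ fun i hi => Submodule.sum_mem _ fun j hj =>
    Submodule.smul_mem _ _ (Submodule.subset_span ⟨_, hS i j ?_ ?_, rfl⟩)
  · exact Nat.lt_succ_iff.mp (Finset.mem_range.mp hi)
  · exact Nat.lt_succ_iff.mp (Finset.mem_range.mp hj)

theorem evalT_rectSection (α : Fin d → Fˣ) (β : Fin e → Fˣ) (p : Fˣ × Fˣ) :
    evalT (rectSection F α β) p =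
      (∏ i, ((p.1 : F) - (α i : F))) * ∏ j, ((p.2 : F) - (β j : F)) := by
  simp [evalT, rectSection]

theorem evalT_rectSection_mem_toricCode
    (hS : ∀ i j : ℕ, i ≤ d → j ≤ e → ((i : ℤ), (j : ℤ)) ∈ S)
    (α : Fin d → Fˣ) (β : Fin e → Fˣ) :
    (fun p : Fˣ × Fˣ => evalT (rectSection F α β) p) ∈ toricCode F S := by
  have hdeg : ∀ {n : ℕ} (γ : Fin n → Fˣ),
      (∏ i, (Polynomial.X - Polynomial.C (γ i : F))).natDegree ≤ n := fun γ => by simp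
  simpa [evalT_rectSection, Polynomial.eval_prod] using
    eval_mul_eval_mem_toricCode hS (hdeg α) (hdeg β)

theorem wt_rectSection [Fintype F] {α : Fin d → Fˣ} {β : Fin e → Fˣ}
    (hα : Function.Injective α) (hβ : Function.Injective β) :
    wt (fun p : Fˣ × Fˣ => evalT (rectSection F α β) p) =
      (Nat.card Fˣ - d) * (Nat.card Fˣ - e) := by
  have hcompl : ∀ {n : ℕ} {γ : Fin n → Fˣ}, Function.Injective γ →
      (Set.range γ)ᶜ.ncard = Nat.card Fˣ - n := fun {n γ} hγ => by
    rw [Set.ncard_compl, Set.ncard_range_of_injective hγ, Nat.card_fin]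
  have hsupp : {p : Fˣ × Fˣ | evalT (rectSection F α β) p ≠ 0} =
      (Set.range α)ᶜ ×ˢ (Set.range β)ᶜ := by
    ext p
    simp [evalT_rectSection, Finset.prod_eq_zero_iff, sub_eq_zero, Units.val_inj,
      @eq_comm Fˣ]
  rw [wt, hsupp, Set.ncard_prod, hcompl hα, hcompl hβ]

end Rectangle

/-- The minimum distance of the toric code of the `d × e` rectangle, with minimum
weight codewords obtained by evaluating `∏ᵢ (x - αᵢ) ∏ⱼ (y - βⱼ)` for distinct
`αᵢ ∈ F*` and distinct `βⱼ ∈ F*`. -/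
theorem rectangle_minDist (q : ℕ) (F : Type) [Field F] [Fintype F]
    (hF : Fintype.card F = q)
    (d e : ℕ) (hd : 1 ≤ d) (hd2 : d + 2 ≤ q) (he : 1 ≤ e) (he2 : e + 2 ≤ q)
    (P : Set (ℝ × ℝ))
    (hP : P = convexHull ℝ
      {((0 : ℝ), (0 : ℝ)), ((d : ℝ), (0 : ℝ)), ((0 : ℝ), (e : ℝ)),
        ((d : ℝ), (e : ℝ))}) :
    (minDist F (toricCode F (latticePts P)) : ℤ) =
      ((q : ℤ) - 1) ^ 2 - (d + e) * ((q : ℤ) - 1) + d * e ∧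
    ∀ (α : Fin d → Fˣ) (β : Fin e → Fˣ),
      Function.Injective α → Function.Injective β →
      (fun p : Fˣ × Fˣ => evalT (rectSection F α β) p) ∈
          toricCode F (latticePts P) ∧
        (fun p : Fˣ × Fˣ => evalT (rectSection F α β) p) ≠ 0 ∧
        wt (fun p : Fˣ × Fˣ => evalT (rectSection F α β) p) =
          minDist F (toricCode F (latticePts P)) := by
  subst hP hF
  have hcard : Nat.card Fˣ = Fintype.card F - 1 := by
    rw [Nat.card_units, Nat.card_eq_fintype_card]
  have hd' : d < Nat.card Fˣ := by omega
  have he' : e < Nat.card Fˣ := by omega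
  set S := latticePts (convexHull ℝ
    {((0 : ℝ), (0 : ℝ)), ((d : ℝ), (0 : ℝ)), ((0 : ℝ), (e : ℝ)), ((d : ℝ), (e : ℝ))})
  have hmem : ∀ (α : Fin d → Fˣ) (β : Fin e → Fˣ),
      (fun p : Fˣ × Fˣ => evalT (rectSection F α β) p) ∈ toricCode F S :=
    evalT_rectSection_mem_toricCode fun i j hi hj =>
      mem_latticePts_rectangle.mpr (by simp [hi, hj])
  have hne : ∀ (α : Fin d → Fˣ) (β : Fin e → Fˣ), Function.Injective α → Function.Injective β →
      (fun p : Fˣ × Fˣ => evalT (rectSection F α β) p) ≠ 0 := fun α β hα hβ h => by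
    have hpos := Nat.mul_pos (Nat.sub_pos_of_lt hd') (Nat.sub_pos_of_lt he')
    rw [← wt_rectSection hα hβ, h] at hpos
    simp [wt] at hpos
  have := Fintype.ofFinite Fˣ
  have hexists : ∀ n < Nat.card Fˣ, ∃ γ : Fin n → Fˣ, Function.Injective γ := fun n hn => by
    obtain ⟨γ⟩ := Function.Embedding.nonempty_of_card_le (α := Fin n) (β := Fˣ)
      (by rw [Fintype.card_fin, ← Nat.card_eq_fintype_card]; exact hn.le)
    exact ⟨γ, γ.injective⟩
  have hmin : minDist F (toricCode F S) = (Nat.card Fˣ - d) * (Nat.card Fˣ - e) := by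
    obtain ⟨α, hα⟩ := hexists d hd'
    obtain ⟨β, hβ⟩ := hexists e he'
    refine IsLeast.csInf_eq ⟨⟨_, hmem α β, hne α β hα hβ, wt_rectSection hα hβ⟩, ?_⟩
    rintro _ ⟨c, hc, hc0, rfl⟩
    exact mul_le_wt_of_mem_toricCode (fun m hm => mem_latticePts_rectangle.mp hm) hc hc0
  refine ⟨?_, fun α β hα hβ =>
    ⟨hmem α β, hne α β hα hβ, (wt_rectSection hα hβ).trans hmin.symm⟩⟩
  rw [hmin]
  rw [Nat.cast_mul, Nat.cast_sub hd'.le, Nat.cast_sub he'.le, hcard,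
    Nat.cast_sub (show 1 ≤ Fintype.card F by omega), Nat.cast_one]
  ring
end

section
/- Let K be a field and let f, g ∈ K[x,y] be nonzero polynomials. Then the Newton polygon of the product satisfies NP(fg) = NP(f) + NP(g), where the sum on the right is the Minkowski sum. -/
open Pointwise

/-- An extreme point of a Minkowski sum decomposes uniquely as a sum. -/
theorem eq_and_eq_of_add_mem_extremePoints {E : Type*} [AddCommGroup E] [Module ℝ E]
    {A B : Set E} {a a' b b' : E} (ha : a ∈ A) (hb : b ∈ B) (ha' : a' ∈ A) (hb' : b' ∈ B)
    (hext : a + b ∈ (A + B).extremePoints ℝ) (h : a' + b' = a + b) : a' = a ∧ b' = b := by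
  have hmid : a + b ∈ openSegment ℝ (a + b') (a' + b) := by
    refine ⟨1 / 2, 1 / 2, by norm_num, by norm_num, by norm_num, ?_⟩
    rw [← smul_add, show a + b' + (a' + b) = (a + b) + (a' + b') by abel, h, ← two_smul ℝ,
      smul_smul]
    norm_num
  have hb_eq : b' = b := add_left_cancel
    (hext.2 (Set.add_mem_add ha hb') (Set.add_mem_add ha' hb) hmid)
  exact ⟨by simpa [hb_eq] using h, hb_eq⟩

/-- The exponent vector of a bivariate monomial as a point of `ℝ²`. -/
def exponentPoint : (Fin 2 →₀ ℕ) →+ ℝ × ℝ where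
  toFun d := ((d 0 : ℝ), (d 1 : ℝ))
  map_zero' := by simp
  map_add' d e := by simp

theorem exponentPoint_injective : Function.Injective exponentPoint := by
  intro d e h
  have h' : (d 0 : ℝ) = e 0 ∧ (d 1 : ℝ) = e 1 := Prod.ext_iff.mp h
  ext i
  fin_cases i
  · exact_mod_cast h'.1
  · exact_mod_cast h'.2

theorem NP_eq_convexHull_exponentPoint {K : Type} [CommSemiring K] (f : MvPolynomial (Fin 2) K) :
    NP f = convexHull ℝ (exponentPoint '' (f.support : Set (Fin 2 →₀ ℕ))) := by
  simp [NP, suppZ, Set.image_image, toR2, exponentPoint]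

theorem mem_support_mul_of_unique {σ K : Type*} [CommSemiring K] [NoZeroDivisors K]
    {f g : MvPolynomial σ K} {a b : σ →₀ ℕ} (ha : a ∈ f.support) (hb : b ∈ g.support)
    (huniq : ∀ a' ∈ f.support, ∀ b' ∈ g.support, a' + b' = a + b → a' = a ∧ b' = b) :
    a + b ∈ (f * g).support := by
  classical
  rw [MvPolynomial.mem_support_iff, MvPolynomial.coeff_mul, Finset.sum_eq_single (a, b)]
  · exact mul_ne_zero (MvPolynomial.mem_support_iff.mp ha) (MvPolynomial.mem_support_iff.mp hb)
  · rintro ⟨a', b'⟩ hmem hne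
    by_contra hzero
    obtain ⟨rfl, rfl⟩ := huniq a' (MvPolynomial.mem_support_iff.mpr (left_ne_zero_of_mul hzero))
      b' (MvPolynomial.mem_support_iff.mpr (right_ne_zero_of_mul hzero))
      (Finset.HasAntidiagonal.mem_antidiagonal.mp hmem)
    exact hne rfl
  · simp

theorem extremePoints_NP_add_subset {K : Type} [CommSemiring K] [NoZeroDivisors K]
    (f g : MvPolynomial (Fin 2) K) :
    (NP f + NP g).extremePoints ℝ ⊆
      exponentPoint '' ((f * g).support : Set (Fin 2 →₀ ℕ)) := by
  intro e he
  have hmem : e ∈ exponentPoint '' (f.support : Set (Fin 2 →₀ ℕ)) +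
      exponentPoint '' (g.support : Set (Fin 2 →₀ ℕ)) := by
    apply extremePoints_convexHull_subset (𝕜 := ℝ)
    rwa [convexHull_add, ← NP_eq_convexHull_exponentPoint, ← NP_eq_convexHull_exponentPoint]
  obtain ⟨_, ⟨a, ha, rfl⟩, _, ⟨b, hb, rfl⟩, rfl⟩ := hmem
  have mem_NP : ∀ {p : MvPolynomial (Fin 2) K} {d : Fin 2 →₀ ℕ}, d ∈ p.support →
      exponentPoint d ∈ NP p := fun {p d} hd => by
    rw [NP_eq_convexHull_exponentPoint]
    exact subset_convexHull ℝ _ ⟨d, hd, rfl⟩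
  refine ⟨a + b, mem_support_mul_of_unique ha hb fun a' ha' b' hb' h => ?_, map_add _ _ _⟩
  have huniq := eq_and_eq_of_add_mem_extremePoints (mem_NP ha) (mem_NP hb) (mem_NP ha')
    (mem_NP hb') he (by rw [← map_add, ← map_add, h])
  exact ⟨exponentPoint_injective huniq.1, exponentPoint_injective huniq.2⟩

theorem isCompact_NP {K : Type} [CommSemiring K] (f : MvPolynomial (Fin 2) K) :
    IsCompact (NP f) := by
  rw [NP_eq_convexHull_exponentPoint]
  exact (f.support.finite_toSet.image _).isCompact_convexHull ℝ

theorem NP_mul_subset {K : Type} [CommSemiring K] (f g : MvPolynomial (Fin 2) K) :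
    NP (f * g) ⊆ NP f + NP g := by
  classical
  simp only [NP_eq_convexHull_exponentPoint]
  rw [← convexHull_add, ← Set.image_add]
  refine convexHull_mono (Set.image_mono ?_)
  exact_mod_cast MvPolynomial.support_mul f g

/-- The Newton polygon of a product of nonzero bivariate polynomials over a field
is the Minkowski sum of the Newton polygons of the factors. -/
theorem newton_polygon_mul (K : Type) [Field K]
    (f g : MvPolynomial (Fin 2) K) (hf : f ≠ 0) (hg : g ≠ 0) :
    NP (f * g) = NP f + NP g := by
  refine (NP_mul_subset f g).antisymm ?_
  have hconvex : Convex ℝ (NP f + NP g) := (convex_convexHull ℝ _).add (convex_convexHull ℝ _)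
  rw [← closure_convexHull_extremePoints ((isCompact_NP f).add (isCompact_NP g)) hconvex]
  refine closure_minimal ?_ (isCompact_NP (f * g)).isClosed
  rw [NP_eq_convexHull_exponentPoint (f * g)]
  exact convexHull_mono (extremePoints_NP_add_subset f g)
end

section
/- Let P₁, …, P_m ⊆ ℝ² be nontrivial integral convex polygons. Then the Minkowski sum P₁ + ⋯ + P_m contains at least m + 1 lattice points; that is, #(P₁ + ⋯ + P_m) ≥ m + 1. (Each additional Minkowski summand contributes at least one new lattice point to the sum.) -/
open Pointwise

/-- The lattice points of a bounded subset of the plane form a finite set. -/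
theorem finite_latticePts {P : Set (ℝ × ℝ)} (hP : Bornology.IsBounded P) :
    (latticePts P).Finite := by
  obtain ⟨R, hR⟩ := hP.exists_norm_le
  refine (Set.finite_Icc ((-⌈R⌉, -⌈R⌉) : ℤ × ℤ) (⌈R⌉, ⌈R⌉)).subset fun x hx => ?_
  have h : max |(x.1 : ℝ)| |(x.2 : ℝ)| ≤ R := hR _ hx
  have h₁ := abs_le.1 (((le_max_left _ _).trans h).trans (Int.le_ceil R))
  have h₂ := abs_le.1 (((le_max_right _ _).trans h).trans (Int.le_ceil R))
  exact ⟨⟨by exact_mod_cast h₁.1, by exact_mod_cast h₂.1⟩,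
    ⟨by exact_mod_cast h₁.2, by exact_mod_cast h₂.2⟩⟩

theorem IsIntPolygon.isCompact {P : Set (ℝ × ℝ)} (hP : IsIntPolygon P) : IsCompact P := by
  obtain ⟨V, -, rfl⟩ := hP
  exact (V.finite_toSet.image _).isCompact_convexHull (𝕜 := ℝ)

/-- A nontrivial integral convex polygon contains at least two lattice points. -/
theorem IsIntPolygon.exists_finset_two_le_card {P : Set (ℝ × ℝ)} (hP : IsIntPolygon P)
    (hn : P.Nontrivial) : ∃ T : Finset (ℤ × ℤ), ↑T ⊆ latticePts P ∧ 2 ≤ T.card := by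
  obtain ⟨V, hV, rfl⟩ := hP
  refine ⟨V, fun x hx => subset_convexHull ℝ _ (Set.mem_image_of_mem _ hx), ?_⟩
  by_contra h
  obtain ⟨v, rfl⟩ := Finset.card_eq_one.1 (by have := hV.card_pos; omega : V.card = 1)
  simp at hn

theorem toR2_add_s11 (x y : ℤ × ℤ) : toR2 (x + y) = toR2 x + toR2 y := by
  simp [toR2]

theorem add_subset_latticePts_add {P Q : Set (ℝ × ℝ)} {S T : Finset (ℤ × ℤ)}
    (hS : ↑S ⊆ latticePts P) (hT : ↑T ⊆ latticePts Q) :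
    ↑(S + T) ⊆ latticePts (P + Q) := by
  intro x hx
  obtain ⟨a, ha, b, hb, rfl⟩ := Finset.mem_add.1 (Finset.mem_coe.1 hx)
  change toR2 (a + b) ∈ P + Q
  rw [toR2_add_s11]
  exact Set.add_mem_add (hS ha) (hT hb)

/-- A Minkowski sum of nontrivial integral convex polygons contains more lattice points than it
has summands. -/
theorem exists_finset_card_lt_of_sum {ι : Type*} (s : Finset ι) (P : ι → Set (ℝ × ℝ))
    (hP : ∀ i ∈ s, IsIntPolygon (P i) ∧ (P i).Nontrivial) :
    ∃ T : Finset (ℤ × ℤ), ↑T ⊆ latticePts (∑ i ∈ s, P i) ∧ s.card + 1 ≤ T.card := by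
  classical
  induction s using Finset.induction_on with
  | empty => exact ⟨{0}, by simp [latticePts, toR2], by simp⟩
  | insert i s hi ih =>
    obtain ⟨T, hT, hTc⟩ := ih fun j hj => hP j (Finset.mem_insert_of_mem hj)
    obtain ⟨hpoly, hnon⟩ := hP i (Finset.mem_insert_self i s)
    obtain ⟨S, hS, hSc⟩ := hpoly.exists_finset_two_le_card hnon
    refine ⟨S + T, ?_, ?_⟩
    · rw [Finset.sum_insert hi]
      exact add_subset_latticePts_add hS hT
    · have := cauchy_davenport_of_isAddTorsionFree (s := S) (t := T)
        (Finset.card_pos.1 (by omega)) (Finset.card_pos.1 (by omega))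
      rw [Finset.card_insert_of_notMem hi]
      omega

/-- A Minkowski sum of `m` nontrivial integral convex polygons contains at least
`m + 1` lattice points. -/
theorem minkowski_sum_lattice_points (m : ℕ) (P : Fin m → Set (ℝ × ℝ))
    (hP : ∀ i, IsIntPolygon (P i) ∧ (P i).Nontrivial) :
    m + 1 ≤ numPts (∑ i, P i) := by
  obtain ⟨T, hT, hTc⟩ := exists_finset_card_lt_of_sum Finset.univ P fun i _ => hP i
  have hcompact : IsCompact (∑ i, P i) :=
    Finset.sum_induction P IsCompact (fun _ _ => IsCompact.add) isCompact_singleton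
      fun i _ => (hP i).1.isCompact
  rw [Finset.card_univ, Fintype.card_fin] at hTc
  calc m + 1 ≤ T.card := hTc
    _ = (T : Set (ℤ × ℤ)).ncard := (Set.ncard_coe_finset T).symm
    _ ≤ numPts (∑ i, P i) := Set.ncard_le_ncard hT (finite_latticePts hcompact.isBounded)
end

section
/- Let P be the triangle P = conv{(0,0),(1,4),(4,1)} ⊆ ℝ². Then for every prime power q ≥ 6 (so that P is properly contained in □_{q−1}), d(C_P(𝔽_q)) ≤ (q−1)² − 3(q−1). In particular, d(C_P(𝔽_8)) ≤ 28. -/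
open Pointwise

/-- The lattice points `(k, 1)` with `1 ≤ k ≤ 4` lie in the triangle `conv{(0,0),(1,4),(4,1)}`. -/
lemma mem_latticePts_triangle {k : ℤ} (h1 : 1 ≤ k) (h4 : k ≤ 4) :
    (k, 1) ∈ latticePts (convexHull ℝ
      {((0 : ℝ), (0 : ℝ)), ((1 : ℝ), (4 : ℝ)), ((4 : ℝ), (1 : ℝ))}) := by
  have h1' : (1 : ℝ) ≤ k := by exact_mod_cast h1
  have h4' : (k : ℝ) ≤ 4 := by exact_mod_cast h4
  rw [latticePts, Set.mem_ofPred_eq, convexHull_insert (by simp), convexHull_pair,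
    convexJoin_singleton_left]
  simp only [Set.mem_iUnion]
  refine ⟨((4 - k : ℝ) / (3 * k + 3) * 1 + (4 * k - 1) / (3 * k + 3) * 4,
    (4 - k : ℝ) / (3 * k + 3) * 4 + (4 * k - 1) / (3 * k + 3) * 1),
    ⟨(4 - k) / (3 * k + 3), (4 * k - 1) / (3 * k + 3), ?_, ?_, ?_, ?_⟩,
    ⟨(4 - k) / 5, (k + 1) / 5, ?_, ?_, ?_, ?_⟩⟩
  · exact div_nonneg (by linarith) (by linarith)
  · exact div_nonneg (by linarith) (by linarith)
  · have : (3 * k + 3 : ℝ) ≠ 0 := by linarith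
    field_simp
    ring
  · simp
  · linarith
  · linarith
  · ring
  · have : (k + 1 : ℝ) ≠ 0 := by linarith
    have : (3 * k + 3 : ℝ) ≠ 0 := by linarith
    ext <;> simp [toR2] <;> field_simp <;> ring

/-- The word of `x y (x - a) (x - b) (x - c)` belongs to any toric code whose exponent set
contains `(1,1)`, `(2,1)`, `(3,1)` and `(4,1)`. -/
lemma cubic_word_mem_toricCode {F : Type} [Field F] {S : Set (ℤ × ℤ)}
    (hS : ∀ k : ℤ, 1 ≤ k → k ≤ 4 → (k, 1) ∈ S) (a b c : F) :
    (fun p : Fˣ × Fˣ => (p.1 * p.2 * ((p.1 - a) * (p.1 - b) * (p.1 - c)) : F)) ∈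
      toricCode F S := by
  have hmem : ∀ k : ℤ, 1 ≤ k → k ≤ 4 → evalVec F (k, 1) ∈ toricCode F S := fun k h1 h4 =>
    Submodule.subset_span ⟨_, hS k h1 h4, rfl⟩
  have hword : (fun p : Fˣ × Fˣ => (p.1 * p.2 * ((p.1 - a) * (p.1 - b) * (p.1 - c)) : F)) =
      evalVec F (4, 1) - (a + b + c) • evalVec F (3, 1)
        + (a * b + a * c + b * c) • evalVec F (2, 1) - (a * b * c) • evalVec F (1, 1) := by
    funext p
    simp only [evalVec, Pi.add_apply, Pi.sub_apply, Pi.smul_apply, smul_eq_mul, Units.val_mul,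
      Units.val_pow_eq_pow_val, zpow_ofNat]
    ring
  rw [hword]
  exact Submodule.sub_mem _ (Submodule.add_mem _ (Submodule.sub_mem _
    (hmem 4 (by norm_num) (by norm_num))
    (Submodule.smul_mem _ _ (hmem 3 (by norm_num) (by norm_num))))
    (Submodule.smul_mem _ _ (hmem 2 (by norm_num) (by norm_num))))
    (Submodule.smul_mem _ _ (hmem 1 (by norm_num) (by norm_num)))

/-- For distinct units `a, b, c`, the word of `x y (x - a) (x - b) (x - c)` has weight
`(q - 4) (q - 1)`. -/
lemma wt_cubic_word {F : Type} [Field F] [Fintype F] {a b c : Fˣ}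
    (hab : a ≠ b) (hac : a ≠ c) (hbc : b ≠ c) :
    wt (fun p : Fˣ × Fˣ => (p.1 * p.2 * ((p.1 - a) * (p.1 - b) * (p.1 - c)) : F)) =
      (Fintype.card F - 4) * (Fintype.card F - 1) := by
  classical
  have hset : {p : Fˣ × Fˣ | (p.1 * p.2 * ((p.1 - a) * (p.1 - b) * (p.1 - c)) : F) ≠ 0} =
      ((({a, b, c} : Finset Fˣ)ᶜ ×ˢ Finset.univ : Finset (Fˣ × Fˣ)) : Set (Fˣ × Fˣ)) := by
    ext p
    simp [sub_eq_zero, Units.ext_iff]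
    tauto
  have hcard : ({a, b, c} : Finset Fˣ).card = 3 :=
    Finset.card_eq_three.mpr ⟨a, b, c, hab, hac, hbc, rfl⟩
  rw [wt, hset, Set.ncard_coe_finset, Finset.card_product, Finset.card_compl, hcard,
    Finset.card_univ, Fintype.card_units, Nat.sub_sub]

/-- Over a field with `q > 4` elements, a toric code has minimum distance at most
`(q - 4) (q - 1)` as soon as the exponent set contains `(1,1)`, `(2,1)`, `(3,1)`, `(4,1)`. -/
lemma minDist_toricCode_le {F : Type} [Field F] [Fintype F] {S : Set (ℤ × ℤ)}
    (hS : ∀ k : ℤ, 1 ≤ k → k ≤ 4 → (k, 1) ∈ S) (hq : 4 < Fintype.card F) :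
    minDist F (toricCode F S) ≤ (Fintype.card F - 4) * (Fintype.card F - 1) := by
  classical
  obtain ⟨T, -, hT⟩ := Finset.exists_subset_card_eq
    (show 3 ≤ (Finset.univ : Finset Fˣ).card by
      rw [Finset.card_univ, Fintype.card_units]; omega)
  obtain ⟨a, b, c, hab, hac, hbc, -⟩ := Finset.card_eq_three.mp hT
  have hwt := wt_cubic_word hab hac hbc
  refine Nat.sInf_le ⟨_, cubic_word_mem_toricCode hS (a : F) b c, fun h0 => ?_, hwt⟩
  have hpos : 0 < (Fintype.card F - 4) * (Fintype.card F - 1) :=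
    Nat.mul_pos (by omega) (by omega)
  rw [h0] at hwt
  simp [wt] at hwt
  omega

/-- Example 5.5: upper bound for the minimum distance of the toric code of the
triangle `conv{(0,0),(1,4),(4,1)}`; in particular `d(C_P(𝔽₈)) ≤ 28`. -/
theorem joyner_triangle_upper (q : ℕ) (F : Type) [Field F] [Fintype F]
    (hF : Fintype.card F = q) (hq : 6 ≤ q)
    (P : Set (ℝ × ℝ))
    (hP : P = convexHull ℝ
      {((0 : ℝ), (0 : ℝ)), ((1 : ℝ), (4 : ℝ)), ((4 : ℝ), (1 : ℝ))}) :
    (minDist F (toricCode F (latticePts P)) : ℤ) ≤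
        ((q : ℤ) - 1) ^ 2 - 3 * ((q : ℤ) - 1) ∧
      (q = 8 → minDist F (toricCode F (latticePts P)) ≤ 28) := by
  have hle := minDist_toricCode_le (F := F) (S := latticePts P)
    (fun k h1 h4 => hP ▸ mem_latticePts_triangle h1 h4) (by omega)
  rw [hF] at hle
  refine ⟨?_, fun h8 => by subst h8; exact hle⟩
  have hle' : (minDist F (toricCode F (latticePts P)) : ℤ) ≤
      (((q - 4) * (q - 1) : ℕ) : ℤ) := by exact_mod_cast hle
  rw [Nat.cast_mul, Nat.cast_sub (by omega), Nat.cast_sub (by omega)] at hle'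
  push_cast at hle'
  linarith
end

section
/- Let P be the hexagon P = conv{(1,0),(2,0),(0,1),(1,2),(3,2),(3,3)} ⊆ ℝ². Then for every prime power q ≥ 5, d(C_P(𝔽_q)) ≤ (q−1)² − 3(q−1) + 2. (A codeword of this weight is obtained by evaluating a section of the form x(x−a)(y−b)(y−c) with a, b, c ∈ 𝔽_q^* and b ≠ c, whose support lies in the rectangle conv{(1,0),(2,0),(1,2),(2,2)} ⊆ P and which has exactly 3(q−1) − 2 zeroes in (𝔽_q^*)².) -/
open Pointwise

/-- The rectangle `conv{(1,0),(2,0),(1,2),(2,2)}` is contained in the hexagon. -/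
theorem rectangle_subset_latticePts_hexagon {m : ℤ × ℤ}
    (hm : (m.1 = 1 ∨ m.1 = 2) ∧ (m.2 = 0 ∨ m.2 = 1 ∨ m.2 = 2)) :
    m ∈ latticePts (convexHull ℝ
      {((1 : ℝ), (0 : ℝ)), ((2 : ℝ), (0 : ℝ)), ((0 : ℝ), (1 : ℝ)),
        ((1 : ℝ), (2 : ℝ)), ((3 : ℝ), (2 : ℝ)), ((3 : ℝ), (3 : ℝ))}) := by
  set V : Set (ℝ × ℝ) := {((1 : ℝ), (0 : ℝ)), ((2 : ℝ), (0 : ℝ)), ((0 : ℝ), (1 : ℝ)),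
    ((1 : ℝ), (2 : ℝ)), ((3 : ℝ), (2 : ℝ)), ((3 : ℝ), (3 : ℝ))} with hV
  have midpoint_mem : ∀ u v w : ℝ × ℝ, u ∈ convexHull ℝ V → v ∈ convexHull ℝ V →
      u + v = (2 : ℝ) • w → w ∈ convexHull ℝ V := by
    intro u v w hu hv h
    have hw : w = (1 / 2 : ℝ) • u + (1 / 2 : ℝ) • v := by
      rw [← smul_add, h, smul_smul]
      norm_num
    rw [hw]
    exact convex_convexHull ℝ V hu hv (by norm_num) (by norm_num) (by norm_num)
  have h10 : ((1 : ℝ), (0 : ℝ)) ∈ convexHull ℝ V := subset_convexHull ℝ V (by simp [hV])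
  have h20 : ((2 : ℝ), (0 : ℝ)) ∈ convexHull ℝ V := subset_convexHull ℝ V (by simp [hV])
  have h12 : ((1 : ℝ), (2 : ℝ)) ∈ convexHull ℝ V := subset_convexHull ℝ V (by simp [hV])
  have h32 : ((3 : ℝ), (2 : ℝ)) ∈ convexHull ℝ V := subset_convexHull ℝ V (by simp [hV])
  have h22 : ((2 : ℝ), (2 : ℝ)) ∈ convexHull ℝ V :=
    midpoint_mem _ _ _ h12 h32 (by ext <;> norm_num)
  have h11 : ((1 : ℝ), (1 : ℝ)) ∈ convexHull ℝ V :=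
    midpoint_mem _ _ _ h10 h12 (by ext <;> norm_num)
  have h21 : ((2 : ℝ), (1 : ℝ)) ∈ convexHull ℝ V :=
    midpoint_mem _ _ _ h20 h22 (by ext <;> norm_num)
  obtain ⟨m₁, m₂⟩ := m
  rcases hm with ⟨rfl | rfl, rfl | rfl | rfl⟩ <;> simpa [latticePts, toR2]

theorem evalVec_mem_toricCode {F : Type} [Field F] {S : Set (ℤ × ℤ)} {m : ℤ × ℤ}
    (hm : m ∈ S) : evalVec F m ∈ toricCode F S :=
  Submodule.subset_span ⟨m, hm, rfl⟩

theorem evalT_section {F : Type} [Field F] (a b c : F) (p : Fˣ × Fˣ) :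
    evalT (MvPolynomial.X 0 * (MvPolynomial.X 0 - MvPolynomial.C a) *
      (MvPolynomial.X 1 - MvPolynomial.C b) * (MvPolynomial.X 1 - MvPolynomial.C c)) p =
      p.1 * (p.1 - a) * (p.2 - b) * (p.2 - c) := by
  simp [evalT]

theorem section_mem_toricCode {F : Type} [Field F] {S : Set (ℤ × ℤ)}
    (hS : ∀ m : ℤ × ℤ, (m.1 = 1 ∨ m.1 = 2) ∧ (m.2 = 0 ∨ m.2 = 1 ∨ m.2 = 2) → m ∈ S)
    (a b c : F) :
    (fun p : Fˣ × Fˣ => (p.1 * (p.1 - a) * (p.2 - b) * (p.2 - c) : F)) ∈ toricCode F S := by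
  have expansion : (fun p : Fˣ × Fˣ => (p.1 * (p.1 - a) * (p.2 - b) * (p.2 - c) : F)) =
      evalVec F (2, 2) - (b + c) • evalVec F (2, 1) + (b * c) • evalVec F (2, 0)
        - a • evalVec F (1, 2) + (a * (b + c)) • evalVec F (1, 1)
        - (a * b * c) • evalVec F (1, 0) := by
    funext p
    have h2 (u : Fˣ) : u ^ (2 : ℤ) = u ^ 2 := zpow_ofNat u 2
    simp only [evalVec, Pi.add_apply, Pi.sub_apply, Pi.smul_apply, smul_eq_mul, h2, zpow_one,
      zpow_zero, Units.val_mul, Units.val_pow_eq_pow_val, Units.val_one]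
    ring
  have mem (i j : ℤ) (h : (i = 1 ∨ i = 2) ∧ (j = 0 ∨ j = 1 ∨ j = 2)) :
      evalVec F (i, j) ∈ toricCode F S := evalVec_mem_toricCode (hS (i, j) h)
  rw [expansion]
  refine sub_mem (add_mem (sub_mem (add_mem (sub_mem ?_ ?_) ?_) ?_) ?_) ?_
  · exact mem _ _ (by simp)
  all_goals exact Submodule.smul_mem _ _ (mem _ _ (by simp))

theorem section_eq_zero_iff {F : Type} [Field F] (a b c : Fˣ) (p : Fˣ × Fˣ) :
    (p.1 * (p.1 - a) * (p.2 - b) * (p.2 - c) : F) = 0 ↔ p.1 = a ∨ p.2 = b ∨ p.2 = c := by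
  simp [sub_eq_zero, or_assoc, Units.val_inj]

theorem ncard_torus {F : Type} [Field F] [Fintype F] :
    ((Set.univ : Set (Fˣ × Fˣ)).ncard : ℤ) = ((Fintype.card F : ℤ) - 1) ^ 2 := by
  have hpos : 1 ≤ Fintype.card F := Fintype.card_pos
  rw [Set.ncard_univ, Nat.card_prod, Nat.card_units, Nat.card_eq_fintype_card]
  push_cast [hpos]
  ring

/-- The section `x(x-a)(y-b)(y-c)` with `b ≠ c` has weight `(q-2)(q-3)`. -/
theorem wt_section {F : Type} [Field F] [Fintype F] (a b c : Fˣ) (hbc : b ≠ c) :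
    (wt (fun p : Fˣ × Fˣ => (p.1 * (p.1 - a) * (p.2 - b) * (p.2 - c) : F)) : ℤ) =
      ((Fintype.card F : ℤ) - 2) * ((Fintype.card F : ℤ) - 3) := by
  have support_eq :
      {p : Fˣ × Fˣ | (p.1 * (p.1 - a) * (p.2 - b) * (p.2 - c) : F) ≠ 0} =
        ({a}ᶜ : Set Fˣ) ×ˢ ({b, c}ᶜ : Set Fˣ) := by
    ext p
    rw [Set.mem_ofPred_eq, Ne, section_eq_zero_iff]
    simp
  have card_units : Nat.card Fˣ = Fintype.card F - 1 := by
    rw [Nat.card_units, Nat.card_eq_fintype_card]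
  have h₁ := Set.ncard_add_ncard_compl ({a} : Set Fˣ)
  have h₂ := Set.ncard_add_ncard_compl ({b, c} : Set Fˣ)
  rw [Set.ncard_singleton, card_units] at h₁
  rw [Set.ncard_pair hbc, card_units] at h₂
  rw [wt, support_eq, Set.ncard_prod, Nat.cast_mul]
  congr 1 <;> omega

/-- Example 5.6 (upper bound): for the hexagon
`conv{(1,0),(2,0),(0,1),(1,2),(3,2),(3,3)}` and any `q ≥ 5`,
`d(C_P(𝔽_q)) ≤ (q-1)² - 3(q-1) + 2`; moreover each section
`x(x-a)(y-b)(y-c)` with `a,b,c ∈ F*`, `b ≠ c`, has exactly `3(q-1) - 2` zeroes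
in the torus and evaluates to a codeword. -/
theorem hexagon_upper (q : ℕ) (F : Type) [Field F] [Fintype F]
    (hF : Fintype.card F = q) (hq : 5 ≤ q)
    (P : Set (ℝ × ℝ))
    (hP : P = convexHull ℝ
      {((1 : ℝ), (0 : ℝ)), ((2 : ℝ), (0 : ℝ)), ((0 : ℝ), (1 : ℝ)),
        ((1 : ℝ), (2 : ℝ)), ((3 : ℝ), (2 : ℝ)), ((3 : ℝ), (3 : ℝ))}) :
    (minDist F (toricCode F (latticePts P)) : ℤ) ≤
        ((q : ℤ) - 1) ^ 2 - 3 * ((q : ℤ) - 1) + 2 ∧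
      ∀ a b c : Fˣ, b ≠ c →
        (nzeros (MvPolynomial.X 0 * (MvPolynomial.X 0 - MvPolynomial.C ((a : F))) *
            (MvPolynomial.X 1 - MvPolynomial.C ((b : F))) *
            (MvPolynomial.X 1 - MvPolynomial.C ((c : F)))) : ℤ) =
            3 * ((q : ℤ) - 1) - 2 ∧
          (fun p : Fˣ × Fˣ =>
              evalT (MvPolynomial.X 0 * (MvPolynomial.X 0 - MvPolynomial.C ((a : F))) *
                (MvPolynomial.X 1 - MvPolynomial.C ((b : F))) *
                (MvPolynomial.X 1 - MvPolynomial.C ((c : F)))) p) ∈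
            toricCode F (latticePts P) := by
  subst hP hF
  simp only [nzeros, evalT_section]
  refine ⟨?_, fun a b c hbc => ⟨?_, ?_⟩⟩
  · have one_lt : 1 < Nat.card Fˣ := by
      rw [Nat.card_units, Nat.card_eq_fintype_card]
      omega
    have := Finite.one_lt_card_iff_nontrivial.mp one_lt
    obtain ⟨b, c, hbc⟩ := exists_pair_ne Fˣ
    have hw := wt_section (1 : Fˣ) b c hbc
    have hle : minDist F (toricCode F (latticePts _)) ≤ wt _ := Nat.sInf_le ⟨_,
      section_mem_toricCode (fun _ => rectangle_subset_latticePts_hexagon)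
        (1 : Fˣ).val b.val c.val, ?_, rfl⟩
    · have hle' := Int.ofNat_le.mpr hle
      rw [hw] at hle'
      exact hle'.trans (le_of_eq (by ring))
    · intro h0
      rw [h0] at hw
      simp only [wt, Pi.zero_apply, ne_eq, not_true_eq_false, Set.ofPred_false,
        Set.ncard_empty, Nat.cast_zero] at hw
      have hq' : (5 : ℤ) ≤ Fintype.card F := by exact_mod_cast hq
      nlinarith
  · have hw := wt_section a b c hbc
    have hsum := Set.ncard_add_ncard_compl
      {p : Fˣ × Fˣ | (p.1 * (p.1 - a) * (p.2 - b) * (p.2 - c) : F) = 0}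
    rw [Set.compl_ofPred, ← Set.ncard_univ] at hsum
    rw [wt] at hw
    have htorus := ncard_torus (F := F)
    rw [← hsum, Nat.cast_add] at htorus
    linear_combination htorus - hw
  · exact section_mem_toricCode (fun _ => rectangle_subset_latticePts_hexagon) a.val b.val c.val
end

section
/- Let P be the hexagon P = conv{(1,0),(2,0),(0,1),(1,2),(3,2),(3,3)} ⊆ ℝ². Then for every prime power q > 12, d(C_P(𝔽_q)) ≥ (q−1)² − 3(q−1). -/
open Pointwise

/-- A nonzero polynomial of degree at most `n`, given by its coefficient vector, has at most `n`
roots among the units. -/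
lemma card_units_roots_le {F : Type} [Field F] [Fintype Fˣ] [DecidableEq F] {n : ℕ}
    (a : Fin (n + 1) → F) (ha : a ≠ 0) :
    (Finset.univ.filter fun u : Fˣ => ∑ i, a i * (u : F) ^ (i : ℕ) = 0).card ≤ n := by
  have hp : Polynomial.ofFn (n + 1) a ≠ 0 := fun h =>
    ha (Polynomial.injective_ofFn (n + 1) (h.trans (map_zero _).symm))
  have hdeg : (Polynomial.ofFn (n + 1) a).natDegree ≤ n :=
    Nat.le_of_lt_succ (Polynomial.ofFn_natDegree_lt (Nat.succ_pos n) a)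
  have heval (u : F) :
      (Polynomial.ofFn (n + 1) a).eval u = ∑ i, a i * u ^ (i : ℕ) := by
    rw [Polynomial.ofFn_eq_sum_monomial, Polynomial.eval_finsetSum]
    simp
  calc (Finset.univ.filter fun u : Fˣ => ∑ i, a i * (u : F) ^ (i : ℕ) = 0).card
      ≤ (Polynomial.ofFn (n + 1) a).roots.toFinset.card := by
        refine Finset.card_le_card_of_injOn (fun u : Fˣ => (u : F)) ?_ (Units.val_injective.injOn)
        intro u hu
        simpa [hp, Polynomial.IsRoot, heval] using hu
    _ ≤ n := (Multiset.toFinset_card_le _).trans ((Polynomial.card_roots' _).trans hdeg)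

/-- If outside at most `k` exceptional vertical lines a relation on `α × α` holds at most `n` times
on each line, then it holds at most `(n + k) |α|` times. -/
lemma card_filter_prod_le {α : Type} [Fintype α] [DecidableEq α] (r : α × α → Prop)
    [DecidablePred r] (B : Finset α) (n k : ℕ) (hB : B.card ≤ k)
    (hr : ∀ x ∉ B, (Finset.univ.filter fun y => r (x, y)).card ≤ n) :
    (Finset.univ.filter r).card ≤ (n + k) * Fintype.card α := by
  have hsum : (Finset.univ.filter r).card
      = ∑ x, (Finset.univ.filter fun y => r (x, y)).card := by
    simp only [Finset.card_filter, Fintype.sum_prod_type]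
  have hline (x : α) : (Finset.univ.filter fun y => r (x, y)).card
      ≤ n + if x ∈ B then Fintype.card α else 0 := by
    split_ifs with hx
    · exact (Finset.card_le_univ _).trans (Nat.le_add_left _ _)
    · exact hr x hx
  calc (Finset.univ.filter r).card
      ≤ ∑ x, (n + if x ∈ B then Fintype.card α else 0) :=
        hsum.trans_le (Finset.sum_le_sum fun x _ => hline x)
    _ = (n + B.card) * Fintype.card α := by
        simp [Finset.sum_add_distrib]
        ring
    _ ≤ (n + k) * Fintype.card α := by gcongr

/-- The lattice points of the hexagon. -/
lemma hexagon_latticePts_subset :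
    latticePts (convexHull ℝ
      {((1 : ℝ), (0 : ℝ)), ((2 : ℝ), (0 : ℝ)), ((0 : ℝ), (1 : ℝ)),
        ((1 : ℝ), (2 : ℝ)), ((3 : ℝ), (2 : ℝ)), ((3 : ℝ), (3 : ℝ))}) ⊆
      {(1, 0), (2, 0), (0, 1), (1, 1), (2, 1), (1, 2), (2, 2), (3, 2), (3, 3)} := by
  rintro ⟨m, n⟩ hm
  have half (u v w : ℝ) (h10 : u ≤ w) (h20 : 2 * u ≤ w) (h01 : v ≤ w) (h12 : u + 2 * v ≤ w)
      (h32 : 3 * u + 2 * v ≤ w) (h33 : 3 * u + 3 * v ≤ w) : m * u + n * v ≤ w := by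
    have hconv : Convex ℝ {p : ℝ × ℝ | p.1 * u + p.2 * v ≤ w} :=
      convex_halfSpace_le ⟨fun p p' => by simp; ring, fun c p => by simp; ring⟩ w
    refine convexHull_min ?_ hconv hm
    rintro p (rfl | rfl | rfl | rfl | rfl | rfl) <;> simp <;> linarith
  have h1 := half 0 (-1) 0 (by norm_num) (by norm_num) (by norm_num) (by norm_num) (by norm_num)
    (by norm_num)
  have h2 := half 1 0 3 (by norm_num) (by norm_num) (by norm_num) (by norm_num) (by norm_num)
    (by norm_num)
  have h3 := half (-1) (-1) (-1) (by norm_num) (by norm_num) (by norm_num) (by norm_num)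
    (by norm_num) (by norm_num)
  have h4 := half 2 (-1) 4 (by norm_num) (by norm_num) (by norm_num) (by norm_num) (by norm_num)
    (by norm_num)
  have h5 := half (-1) 2 3 (by norm_num) (by norm_num) (by norm_num) (by norm_num) (by norm_num)
    (by norm_num)
  have h6 := half (-1) 1 1 (by norm_num) (by norm_num) (by norm_num) (by norm_num) (by norm_num)
    (by norm_num)
  ring_nf at h1 h2 h3 h4 h5 h6
  norm_cast at h1 h2 h3 h4 h5 h6
  simp only [Set.mem_insert_iff, Set.mem_singleton_iff, Prod.mk.injEq]
  lia

/-- The value at `(x, y)` of the polynomial supported on the hexagon whose coefficient of `y ^ k`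
is given by the `k`-th vector. -/
def hexagonEval {F : Type} [Field F] (a : Fin 2 → F) (b c : Fin 3 → F) (d : F) (x y : F) : F :=
  x * (a 0 + a 1 * x) + (b 0 + b 1 * x + b 2 * x ^ 2) * y
    + x * (c 0 + c 1 * x + c 2 * x ^ 2) * y ^ 2 + x ^ 3 * d * y ^ 3

/-- Every codeword of the hexagon code is given by a polynomial supported on the hexagon. -/
lemma exists_hexagonEval_of_mem {F : Type} [Field F] {S : Set (ℤ × ℤ)}
    (hS : S ⊆ {(1, 0), (2, 0), (0, 1), (1, 1), (2, 1), (1, 2), (2, 2), (3, 2), (3, 3)})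
    {w : Fˣ × Fˣ → F} (hw : w ∈ toricCode F S) :
    ∃ a b c d, ∀ p : Fˣ × Fˣ, w p = hexagonEval a b c d (p.1 : F) (p.2 : F) := by
  induction hw using Submodule.span_induction with
  | mem w hw =>
    obtain ⟨m, hm, rfl⟩ := hw
    rcases hS hm with rfl | rfl | rfl | rfl | rfl | rfl | rfl | rfl | rfl
    · exact ⟨![1, 0], 0, 0, 0, fun p => by simp [evalVec, hexagonEval]⟩
    · exact ⟨![0, 1], 0, 0, 0, fun p => by simp [evalVec, hexagonEval, zpow_ofNat, sq]⟩
    · exact ⟨0, ![1, 0, 0], 0, 0, fun p => by simp [evalVec, hexagonEval]⟩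
    · exact ⟨0, ![0, 1, 0], 0, 0, fun p => by simp [evalVec, hexagonEval]⟩
    · exact ⟨0, ![0, 0, 1], 0, 0, fun p => by simp [evalVec, hexagonEval, zpow_ofNat]⟩
    · exact ⟨0, 0, ![1, 0, 0], 0, fun p => by simp [evalVec, hexagonEval, zpow_ofNat]⟩
    · exact ⟨0, 0, ![0, 1, 0], 0, fun p => by simp [evalVec, hexagonEval, zpow_ofNat]; ring⟩
    · exact ⟨0, 0, ![0, 0, 1], 0, fun p => by simp [evalVec, hexagonEval, zpow_ofNat]; ring⟩
    · exact ⟨0, 0, 0, 1, fun p => by simp [evalVec, hexagonEval, zpow_ofNat]⟩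
  | zero => exact ⟨0, 0, 0, 0, fun p => by simp [hexagonEval]⟩
  | add w w' _ _ ih ih' =>
    obtain ⟨a, b, c, d, h⟩ := ih
    obtain ⟨a', b', c', d', h'⟩ := ih'
    refine ⟨a + a', b + b', c + c', d + d', fun p => ?_⟩
    simp only [Pi.add_apply, h, h', hexagonEval]
    ring
  | smul t w _ ih =>
    obtain ⟨a, b, c, d, h⟩ := ih
    refine ⟨t • a, t • b, t • c, t • d, fun p => ?_⟩
    simp only [Pi.smul_apply, smul_eq_mul, h, hexagonEval]
    ring

/-- A nonzero polynomial supported on the hexagon has at most `3 (q - 1)` zeros in the torus. -/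
lemma card_hexagonEval_zeros_le {F : Type} [Field F] [Fintype Fˣ] [DecidableEq F]
    (a : Fin 2 → F) (b c : Fin 3 → F) (d : F)
    (hne : ¬ (a = 0 ∧ b = 0 ∧ c = 0 ∧ d = 0)) :
    (Finset.univ.filter fun p : Fˣ × Fˣ =>
      hexagonEval a b c d (p.1 : F) (p.2 : F) = 0).card ≤ 3 * Fintype.card Fˣ := by
  by_cases hd : d = 0
  · subst hd
    by_cases ha : a = 0
    · subst ha
      have hlin (x : Fˣ) (h : b 0 + b 1 * x + b 2 * (x : F) ^ 2 ≠ 0 ∨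
          c 0 + c 1 * x + c 2 * (x : F) ^ 2 ≠ 0) : (Finset.univ.filter fun y : Fˣ =>
            hexagonEval 0 b c 0 (x : F) (y : F) = 0).card ≤ 1 := by
        refine le_trans (Finset.card_le_card fun y hy => ?_) (card_units_roots_le
          ![b 0 + b 1 * x + b 2 * (x : F) ^ 2, x * (c 0 + c 1 * x + c 2 * (x : F) ^ 2)] ?_)
        · replace hy := (Finset.mem_filter.mp hy).2
          refine Finset.mem_filter.mpr ⟨Finset.mem_univ y, ?_⟩
          refine (mul_eq_zero.mp ?_).resolve_right y.ne_zero
          rw [← hy]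
          simp [Fin.sum_univ_two, hexagonEval]
          ring
        · intro h0
          have e0 := congrFun h0 0
          have e1 := congrFun h0 1
          simp at e0 e1
          exact h.elim (fun h => h e0) (fun h => h e1)
      by_cases hb : b = 0
      · have hc : c ≠ 0 := fun hc => hne ⟨rfl, hb, hc, rfl⟩
        refine card_filter_prod_le _ _ 1 2 (card_units_roots_le c hc) fun x hx => hlin x (.inr ?_)
        simpa [Fin.sum_univ_three] using hx
      · refine card_filter_prod_le _ _ 1 2 (card_units_roots_le b hb) fun x hx => hlin x (.inl ?_)
        simpa [Fin.sum_univ_three] using hx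
    · refine card_filter_prod_le _ _ 2 1 (card_units_roots_le a ha) fun x hx => ?_
      refine le_trans (Finset.card_le_card fun y hy => ?_) (card_units_roots_le
        ![x * (a 0 + a 1 * x), b 0 + b 1 * x + b 2 * (x : F) ^ 2,
          x * (c 0 + c 1 * x + c 2 * (x : F) ^ 2)] ?_)
      · simpa [Fin.sum_univ_three, hexagonEval] using (Finset.mem_filter.mp hy).2
      · intro h0
        have e0 := congrFun h0 0
        simp at e0
        simp [Fin.sum_univ_two] at hx
        exact hx e0
  · refine card_filter_prod_le _ ∅ 3 0 (by simp) fun x _ => ?_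
    refine le_trans (Finset.card_le_card fun y hy => ?_) (card_units_roots_le
      ![x * (a 0 + a 1 * x), b 0 + b 1 * x + b 2 * (x : F) ^ 2,
        x * (c 0 + c 1 * x + c 2 * (x : F) ^ 2), x ^ 3 * d] ?_)
    · simpa [Fin.sum_univ_four, hexagonEval] using (Finset.mem_filter.mp hy).2
    · intro h0
      have e3 := congrFun h0 3
      simp at e3
      exact hd e3

/-- Example 5.6 (lower bound): for the hexagon
`conv{(1,0),(2,0),(0,1),(1,2),(3,2),(3,3)}` and any prime power `q > 12`,
`d(C_P(𝔽_q)) ≥ (q-1)² - 3(q-1)`. -/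
theorem hexagon_lower (q : ℕ) (F : Type) [Field F] [Fintype F]
    (hF : Fintype.card F = q) (hq : 12 < q)
    (P : Set (ℝ × ℝ))
    (hP : P = convexHull ℝ
      {((1 : ℝ), (0 : ℝ)), ((2 : ℝ), (0 : ℝ)), ((0 : ℝ), (1 : ℝ)),
        ((1 : ℝ), (2 : ℝ)), ((3 : ℝ), (2 : ℝ)), ((3 : ℝ), (3 : ℝ))}) :
    ((q : ℤ) - 1) ^ 2 - 3 * ((q : ℤ) - 1) ≤
      (minDist F (toricCode F (latticePts P)) : ℤ) := by
  classical
  subst hP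
  set S := latticePts (convexHull ℝ
      {((1 : ℝ), (0 : ℝ)), ((2 : ℝ), (0 : ℝ)), ((0 : ℝ), (1 : ℝ)),
        ((1 : ℝ), (2 : ℝ)), ((3 : ℝ), (2 : ℝ)), ((3 : ℝ), (3 : ℝ))}) with hS
  have hmem : ((1, 0) : ℤ × ℤ) ∈ S := by
    rw [hS, latticePts, Set.mem_ofPred_eq]
    exact subset_convexHull ℝ _ (by simp [toR2])
  have hne : {w | ∃ c ∈ toricCode F S, c ≠ 0 ∧ wt c = w}.Nonempty :=
    ⟨_, evalVec F (1, 0), Submodule.subset_span ⟨_, hmem, rfl⟩,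
      fun h => Units.ne_zero _ (congrFun h 1), rfl⟩
  obtain ⟨w, hw, hw0, hwt⟩ := Nat.sInf_mem hne
  rw [minDist, ← hwt]
  obtain ⟨a, b, c, d, h⟩ := exists_hexagonEval_of_mem hexagon_latticePts_subset hw
  have hzeros := card_hexagonEval_zeros_le a b c d (by
    rintro ⟨rfl, rfl, rfl, rfl⟩
    exact hw0 (funext fun p => by simp [h, hexagonEval]))
  have hwt' : wt w = (Finset.univ.filter fun p : Fˣ × Fˣ =>
      ¬ hexagonEval a b c d (p.1 : F) (p.2 : F) = 0).card := by
    rw [wt, Set.ncard_eq_toFinset_card']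
    simp [h]
  have hadd := Finset.card_filter_add_card_filter_not (s := (Finset.univ : Finset (Fˣ × Fˣ)))
    (fun p => hexagonEval a b c d (p.1 : F) (p.2 : F) = 0)
  rw [← hwt', Finset.card_univ, Fintype.card_prod] at hadd
  have hunits : (Fintype.card Fˣ : ℤ) = q - 1 := by
    rw [Fintype.card_units, hF]
    push_cast [show 1 ≤ q by lia]
    rfl
  rw [← hunits]
  zify at hadd hzeros
  linarith
end
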